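/- For every integer r ≥ 1, the Takagi function τ restricted to Γ_{2r} is strictly increasing and bi-Lipschitz: for all x₁, x₂ ∈ Γ_{2r} with x₁ ≤ x₂, one has 2^{-2r}·(x₂ − x₁) ≤ τ(x₂) − τ(x₁) ≤ 2^{2r}·(x₂ − x₁). -/

import Mathlib

open MeasureTheory Set

/-- Distance from a real number to the nearest integer. -/
noncomputable def distNearestInt (t : ℝ) : ℝ := |t - round t|

/-- The Takagi function. -/
noncomputable def takagi (x : ℝ) : ℝ := ∑' n : ℕ, distNearestInt (2 ^ n * x) / 2 ^ n

/-- The `j`-th binary digit of `x ∈ [0,1)` (binary expansion terminating in `0^∞`). -/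
noncomputable def bdigit (x : ℝ) (j : ℕ) : ℤ := ⌊(2 : ℝ) ^ j * x⌋ - 2 * ⌊(2 : ℝ) ^ (j - 1) * x⌋

/-- The deficient digit function `D_j(x) = j - 2(b_1(x) + ⋯ + b_j(x))`. -/
noncomputable def defDigit (x : ℝ) (j : ℕ) : ℤ := (j : ℤ) - 2 * ∑ i ∈ Finset.Icc 1 j, bdigit x i

/-- The deficient digit set `Ω^L`. -/
noncomputable def OmegaL : Set ℝ := {x | x ∈ Set.Ico (0 : ℝ) 1 ∧ ∀ j : ℕ, 1 ≤ j → 0 ≤ defDigit x j}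

/-- The set `½Ω^L = {x ∈ [0,1) : D_j(x) > 0 for all j ≥ 1}`. -/
noncomputable def halfOmegaL : Set ℝ :=
  {x | x ∈ Set.Ico (0 : ℝ) 1 ∧ ∀ j : ℕ, 1 ≤ j → 0 < defDigit x j}

/-- The Takagi singular function. -/
noncomputable def takagiS (x : ℝ) : ℝ := sSup {y | ∃ t ∈ OmegaL, t ≤ x ∧ y = takagi t + t}

/-- `Ω^L_∞`: points of `Ω^L` with infinitely many balance points. -/
noncomputable def OmegaLinf : Set ℝ :=
  {x ∈ OmegaL | {j : ℕ | 1 ≤ j ∧ defDigit x j = 0}.Infinite}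

/-- `Ω^L_fin = Ω^L \ Ω^L_∞`. -/
noncomputable def OmegaLfin : Set ℝ := OmegaL \ OmegaLinf

/-- `(m, k)` encodes a member `k / 2^(2m)` of the breakpoint set `ℬ'`. -/
noncomputable def breakpoint (m k : ℕ) : Prop :=
  (m = 0 ∧ k = 0) ∨
    (1 ≤ m ∧ 0 < k ∧ k < 2 ^ (2 * m) ∧
      (∀ j : ℕ, 1 ≤ j → j ≤ 2 * m - 1 → 0 ≤ defDigit ((k : ℝ) / 2 ^ (2 * m)) j) ∧
      defDigit ((k : ℝ) / 2 ^ (2 * m)) (2 * m) = 0)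

/-- The fine partition set `Ω^L(B)` for `B = k / 2^(2m)`. -/
noncomputable def fineSet (m k : ℕ) : Set ℝ :=
  {x | ∃ x' ∈ halfOmegaL, x = (k : ℝ) / 2 ^ (2 * m) + x' / 2 ^ (2 * m)}

/-- The set `Γ_{2r}`. -/
noncomputable def Gamma (r : ℕ) : Set ℝ :=
  {x | x ∈ Set.Ico (0 : ℝ) 1 ∧ ∀ j : ℕ, 1 ≤ j →
    ((¬ (2 * r ∣ j) → 0 < defDigit x j) ∧ ((2 * r) ∣ j → defDigit x j = 0))}

/-- The level set `L(y)` of the Takagi function. -/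
noncomputable def levelSet (y : ℝ) : Set ℝ := {x ∈ Set.Icc (0 : ℝ) 1 | takagi x = y}

lemma dni_nonneg (t : ℝ) : 0 ≤ distNearestInt t := abs_nonneg _

lemma dni_le (t : ℝ) : distNearestInt t ≤ 1 / 2 := abs_sub_round t

lemma takagi_term_le (x : ℝ) (n : ℕ) :
    distNearestInt (2 ^ n * x) / 2 ^ n ≤ (1 / 2) * (1 / 2) ^ n := by
  have h := dni_le (2 ^ n * x)
  rw [div_eq_mul_inv, one_div_pow, one_div ((2:ℝ)^n)]
  exact mul_le_mul_of_nonneg_right h (by positivity)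

lemma takagi_summable (x : ℝ) : Summable (fun n : ℕ => distNearestInt (2 ^ n * x) / 2 ^ n) := by
  refine Summable.of_nonneg_of_le (fun n => div_nonneg (dni_nonneg _) (by positivity))
    (takagi_term_le x) ?_
  exact (summable_geometric_two).mul_left _

lemma takagi_nonneg (x : ℝ) : 0 ≤ takagi x :=
  tsum_nonneg (fun n => div_nonneg (dni_nonneg _) (by positivity))

lemma takagi_le_one (x : ℝ) : takagi x ≤ 1 := by
  have h := (takagi_summable x).tsum_le_tsum (takagi_term_le x)
    ((summable_geometric_two).mul_left _)
  rw [tsum_mul_left, tsum_geometric_two] at h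
  unfold takagi
  linarith

lemma takagi_rec (x : ℝ) : takagi x = distNearestInt x + takagi (2 * x) / 2 := by
  unfold takagi
  rw [(takagi_summable x).tsum_eq_zero_add, ← tsum_div_const]
  congr 1
  · simp
  · refine tsum_congr fun n => ?_
    rw [pow_succ, div_div, mul_assoc]

lemma dni_sub_int (t : ℝ) (k : ℤ) : distNearestInt (t - k) = distNearestInt t := by
  unfold distNearestInt
  rw [round_sub_intCast]
  push_cast
  congr 1
  ring

lemma takagi_sub_one (x : ℝ) : takagi (x - 1) = takagi x := by
  unfold takagi
  refine tsum_congr fun n => ?_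
  have := dni_sub_int (2 ^ n * x) (2 ^ n)
  push_cast at this
  rw [← this]
  congr 2
  ring

lemma takagi_low {x : ℝ} (h0 : 0 ≤ x) (h1 : x < 1 / 2) :
    takagi x = x + takagi (2 * x) / 2 := by
  rw [takagi_rec]
  congr 1
  unfold distNearestInt
  have : round x = 0 := by
    rw [round_eq, Int.floor_eq_iff]; constructor <;> push_cast <;> linarith
  rw [this]; simp [abs_of_nonneg h0]

lemma takagi_high {x : ℝ} (h0 : 1 / 2 ≤ x) (h1 : x < 1) :
    takagi x = 1 - x + takagi (2 * x - 1) / 2 := by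
  rw [takagi_rec, takagi_sub_one]
  congr 1
  unfold distNearestInt
  have : round x = 1 := by
    rw [round_eq, Int.floor_eq_iff]; constructor <;> push_cast <;> linarith
  rw [this, abs_of_nonpos (by push_cast; linarith)]; push_cast; ring

lemma bdigit_shift (x : ℝ) (b : ℤ) (i : ℕ) (hi : 1 ≤ i) :
    bdigit x (i + 1) = bdigit (2 * x - b) i := by
  obtain ⟨k, rfl⟩ : ∃ k, i = k + 1 := ⟨i - 1, by omega⟩
  unfold bdigit
  have e1 : ∀ n : ℕ, ⌊(2:ℝ) ^ n * (2 * x - b)⌋ = ⌊(2:ℝ) ^ (n + 1) * x⌋ - 2 ^ n * b := by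
    intro n
    rw [← Int.floor_sub_intCast]
    congr 1
    push_cast
    ring
  simp only [Nat.add_sub_cancel]
  rw [e1, e1]
  ring

lemma defDigit_zero (x : ℝ) : defDigit x 0 = 0 := by simp [defDigit]

lemma defDigit_shift (x : ℝ) (b : ℤ) (hb : bdigit x 1 = b) (i : ℕ) :
    defDigit x (i + 1) = 1 - 2 * b + defDigit (2 * x - b) i := by
  induction i with
  | zero => simp [defDigit, hb]
  | succ k ih =>
    have step : ∀ (y : ℝ) (n : ℕ), defDigit y (n + 1) = defDigit y n + 1 - 2 * bdigit y (n + 1) := by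
      intro y n
      unfold defDigit
      rw [Finset.sum_Icc_succ_top (by omega)]
      push_cast; ring
    rw [step, ih, step (2 * x - b), bdigit_shift x b (k + 1) (by omega)]
    ring

lemma bdigit_low {x : ℝ} (h0 : 0 ≤ x) (h1 : x < 1 / 2) : bdigit x 1 = 0 := by
  have a : ⌊(2:ℝ) * x⌋ = 0 := by
    rw [Int.floor_eq_iff]; constructor <;> push_cast <;> linarith
  have c : ⌊x⌋ = 0 := by
    rw [Int.floor_eq_iff]; constructor <;> push_cast <;> linarith
  simp [bdigit, a, c]

lemma bdigit_high {x : ℝ} (h0 : 1 / 2 ≤ x) (h1 : x < 1) : bdigit x 1 = 1 := by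
  have a : ⌊(2:ℝ) * x⌋ = 1 := by
    rw [Int.floor_eq_iff]; constructor <;> push_cast <;> linarith
  have c : ⌊x⌋ = 0 := by
    rw [Int.floor_eq_iff]; constructor <;> push_cast <;> linarith
  simp [bdigit, a, c]

def GoodState (R j : ℕ) (h : ℤ) (x : ℝ) : Prop :=
  (0 ≤ x ∧ x < 1) ∧ ∀ i : ℕ, (¬ R ∣ j + i → 0 < h + defDigit x i) ∧
    (R ∣ j + i → h + defDigit x i = 0)

lemma GoodState.low {R j : ℕ} {h : ℤ} {x : ℝ} (g : GoodState R j h x) (hx : x < 1 / 2) :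
    GoodState R (j + 1) (h + 1) (2 * x) := by
  obtain ⟨⟨h0, h1⟩, H⟩ := g
  refine ⟨⟨by linarith, by linarith⟩, fun i => ?_⟩
  have := defDigit_shift x 0 (bdigit_low h0 hx) i
  simp only [Int.cast_zero, sub_zero, mul_zero] at this
  have H' := H (i + 1)
  rw [this, show j + (i + 1) = j + 1 + i by ring] at H'
  rw [show h + 1 + defDigit (2 * x) i = h + (1 + defDigit (2 * x) i) by ring]
  exact H'

lemma GoodState.high {R j : ℕ} {h : ℤ} {x : ℝ} (g : GoodState R j h x) (hx : 1 / 2 ≤ x) :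
    GoodState R (j + 1) (h - 1) (2 * x - 1) := by
  obtain ⟨⟨h0, h1⟩, H⟩ := g
  refine ⟨⟨by linarith, by linarith⟩, fun i => ?_⟩
  have := defDigit_shift x 1 (bdigit_high hx h1) i
  simp only [Int.cast_one] at this
  have H' := H (i + 1)
  rw [this, show j + (i + 1) = j + 1 + i by ring] at H'
  rw [show h - 1 + defDigit (2 * x - 1) i = h + (1 - 2 * 1 + defDigit (2 * x - 1) i) by ring]
  exact H'

lemma GoodState.pos {R j : ℕ} {h : ℤ} {x : ℝ} (g : GoodState R j h x) (hj : ¬ R ∣ j) : 0 < h := by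
  have := (g.2 0).1 hj
  rwa [defDigit_zero, add_zero] at this

lemma GoodState.zero {R j : ℕ} {h : ℤ} {x : ℝ} (g : GoodState R j h x) (hj : R ∣ j) : h = 0 := by
  have := (g.2 0).2 hj
  rwa [defDigit_zero, add_zero] at this

lemma path_upper (R : ℕ) : ∀ (m j : ℕ) (h : ℤ) (x : ℝ), GoodState R j h x → R ∣ j + m →
    (∀ i < m, ¬ R ∣ j + i) → (h * x + takagi x ≤ h + (1 / 2) ^ m ∧ h ≤ m) := by
  intro m
  induction m with
  | zero =>
    intro j h x g hd _
    have := g.zero hd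
    subst this
    have := takagi_le_one x
    simpa using this
  | succ m ih =>
    intro j h x g hd hn
    have hp : 0 < h := g.pos (hn 0 (by omega))
    have hp' : (1 : ℝ) ≤ h := by exact_mod_cast hp
    have hd' : R ∣ j + 1 + m := by convert hd using 1; ring
    have hn' : ∀ i < m, ¬ R ∣ j + 1 + i := fun i hi => by
      have := hn (i + 1) (by omega)
      rwa [show j + (i + 1) = j + 1 + i by ring] at this
    rcases lt_or_ge x (1 / 2) with hx | hx
    · obtain ⟨a, b⟩ := ih _ _ _ (g.low hx) hd' hn'
      rw [takagi_low g.1.1 hx]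
      push_cast at a ⊢
      refine ⟨?_, by omega⟩
      rw [pow_succ]; linarith
    · obtain ⟨a, b⟩ := ih _ _ _ (g.high hx) hd' hn'
      rw [takagi_high hx g.1.2]
      push_cast at a ⊢
      refine ⟨?_, by omega⟩
      rw [pow_succ]; linarith

lemma path_lower (R : ℕ) : ∀ (m j : ℕ) (h : ℤ) (x : ℝ), GoodState R j h x → R ∣ j + (m + 1) →
    (∀ i < m + 1, ¬ R ∣ j + i) →
    (2 * (1 / 2) ^ (m + 1) ≤ h * x + takagi x ∧ (1 / 2) ^ (m + 1) ≤ x) := by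
  intro m
  induction m with
  | zero =>
    intro j h x g hd hn
    have hp : 0 < h := g.pos (hn 0 (by omega))
    have hp' : (1 : ℝ) ≤ h := by exact_mod_cast hp
    rcases lt_or_ge x (1 / 2) with hx | hx
    · have := (g.low hx).zero hd
      omega
    · have hh : h = 1 := by have := (g.high hx).zero hd; omega
      subst hh
      rw [takagi_high hx g.1.2]
      have := takagi_nonneg (2 * x - 1)
      push_cast
      constructor <;> linarith
  | succ m ih =>
    intro j h x g hd hn
    have hp : 0 < h := g.pos (hn 0 (by omega))
    have hp' : (1 : ℝ) ≤ h := by exact_mod_cast hp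
    have hd' : R ∣ j + 1 + (m + 1) := by convert hd using 1; ring
    have hn' : ∀ i < m + 1, ¬ R ∣ j + 1 + i := fun i hi => by
      have := hn (i + 1) (by omega)
      rwa [show j + (i + 1) = j + 1 + i by ring] at this
    rcases lt_or_ge x (1 / 2) with hx | hx
    · obtain ⟨a, b⟩ := ih _ _ _ (g.low hx) hd' hn'
      rw [takagi_low g.1.1 hx]
      push_cast at a ⊢
      rw [pow_succ _ (m + 1)]
      constructor <;> linarith
    · obtain ⟨a, b⟩ := ih _ _ _ (g.high hx) hd' hn'
      rw [takagi_high hx g.1.2]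
      push_cast at a ⊢
      rw [pow_succ _ (m + 1)]
      constructor <;> linarith

lemma split_case (R j : ℕ) (hR : 0 < R) (h : ℤ) (x₁ x₂ : ℝ) (g₁ : GoodState R j h x₁)
    (g₂ : GoodState R j h x₂) (hx₁ : x₁ < 1 / 2) (hx₂ : 1 / 2 ≤ x₂) :
    ((2 : ℝ) ^ R)⁻¹ * (x₂ - x₁) ≤ (h * x₂ + takagi x₂) - (h * x₁ + takagi x₁) ∧
      (h * x₂ + takagi x₂) - (h * x₁ + takagi x₁) ≤ (2 : ℝ) ^ R * (x₂ - x₁) := by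
  have k₁ := g₁.low hx₁
  have k₂ := g₂.high hx₂
  have nd : ¬ R ∣ j + 1 := fun hd => by
    have := k₁.zero hd
    have := k₂.zero hd
    omega
  have hmod : 0 < (j + 1) % R := Nat.pos_of_ne_zero fun e => nd (Nat.dvd_of_mod_eq_zero e)
  have hlt : (j + 1) % R < R := Nat.mod_lt _ hR
  obtain ⟨m, hm⟩ : ∃ m, R = (j + 1) % R + (m + 1) := ⟨R - (j + 1) % R - 1, by omega⟩
  have hdm := Nat.div_add_mod (j + 1) R
  have hd : R ∣ j + 1 + (m + 1) := by
    refine ⟨(j + 1) / R + 1, ?_⟩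
    rw [mul_add, mul_one]; omega
  have hn : ∀ i < m + 1, ¬ R ∣ j + 1 + i := by
    intro i hi hdi
    rw [← hdm, add_assoc, Nat.dvd_add_right (dvd_mul_right _ _)] at hdi
    have := Nat.le_of_dvd (by omega) hdi
    omega
  obtain ⟨u, hu⟩ := path_upper R (m + 1) _ _ _ k₁ hd hn
  obtain ⟨l, hl⟩ := path_lower R m _ _ _ k₂ hd hn
  have t1 := takagi_nonneg (2 * x₁)
  have t2 := takagi_le_one (2 * x₂ - 1)
  have hmR : m + 1 + 1 ≤ R := by omega
  have hpow : (2 : ℝ) ^ (m + 1) * 2 ≤ 2 ^ R := by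
    rw [← pow_succ]; exact pow_le_pow_right₀ (by norm_num) hmR
  have hm2 : (m + 1 : ℝ) ≤ 2 ^ (m + 1) := by
    exact_mod_cast (Nat.lt_two_pow_self (n := m + 1)).le
  have hu' : (h : ℝ) + 1 ≤ m + 1 := by exact_mod_cast hu
  rw [takagi_low g₁.1.1 hx₁, takagi_high hx₂ g₂.1.2]
  push_cast at u l
  have hP : (0 : ℝ) < 2 ^ (m + 1) := by positivity
  have hQ : (0 : ℝ) < 2 ^ R := by positivity
  have e : (1 / 2 : ℝ) ^ (m + 1) = (2 ^ (m + 1))⁻¹ := by rw [one_div, inv_pow]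
  rw [e] at u l hl
  have hinv : 2 * ((2 : ℝ) ^ R)⁻¹ ≤ (2 ^ (m + 1))⁻¹ := by
    rw [← one_div, ← one_div, mul_one_div, div_le_div_iff₀ hQ hP]; linarith
  have hQi : 0 < ((2 : ℝ) ^ R)⁻¹ := by positivity
  have h01 := g₁.1.1
  have h12 := g₂.1.2
  constructor
  · have : ((2 : ℝ) ^ R)⁻¹ * (x₂ - x₁) ≤ ((2 : ℝ) ^ R)⁻¹ * 1 :=
      mul_le_mul_of_nonneg_left (by linarith) hQi.le
    linarith
  · have hone : 1 ≤ (2 : ℝ) ^ (m + 1) * (2 * x₂ - 1) := by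
      rw [inv_le_iff_one_le_mul₀ hP] at hl; linarith
    have A : ((h : ℝ) + 1) * (2 * x₂ - 2 * x₁) ≤ 2 ^ (m + 1) * (2 * x₂ - 2 * x₁) :=
      mul_le_mul_of_nonneg_right (by linarith) (by linarith)
    have B : (2 : ℝ) ^ (m + 1) * (2 * x₂ - 1) ≤ 2 ^ (m + 1) * (2 * x₂ - 2 * x₁) :=
      mul_le_mul_of_nonneg_left (by linarith) hP.le
    have C : ((2 : ℝ) ^ (m + 1) * 2) * (x₂ - x₁) ≤ 2 ^ R * (x₂ - x₁) :=
      mul_le_mul_of_nonneg_right hpow (by linarith)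
    linarith

lemma main_ind (R : ℕ) (hR : 0 < R) : ∀ (n j : ℕ) (h : ℤ) (x₁ x₂ : ℝ), GoodState R j h x₁ →
    GoodState R j h x₂ → x₁ < x₂ → 1 ≤ 2 ^ n * (x₂ - x₁) →
    ((2 : ℝ) ^ R)⁻¹ * (x₂ - x₁) ≤ (h * x₂ + takagi x₂) - (h * x₁ + takagi x₁) ∧
      (h * x₂ + takagi x₂) - (h * x₁ + takagi x₁) ≤ (2 : ℝ) ^ R * (x₂ - x₁) := by
  intro n
  induction n with
  | zero =>
    intro j h x₁ x₂ g₁ g₂ _ hn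
    have := g₁.1.1
    have := g₂.1.2
    rw [pow_zero] at hn
    linarith
  | succ n ih =>
    intro j h x₁ x₂ g₁ g₂ hlt hn
    rw [pow_succ] at hn
    rcases lt_or_ge x₁ (1 / 2) with hx₁ | hx₁
    · rcases lt_or_ge x₂ (1 / 2) with hx₂ | hx₂
      · obtain ⟨a, b⟩ := ih _ _ _ _ (g₁.low hx₁) (g₂.low hx₂) (by linarith) (by linarith)
        rw [takagi_low g₁.1.1 hx₁, takagi_low g₂.1.1 hx₂]
        push_cast at a b
        constructor <;> linarith
      · exact split_case R j hR h x₁ x₂ g₁ g₂ hx₁ hx₂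
    · have hx₂ : 1 / 2 ≤ x₂ := by linarith
      obtain ⟨a, b⟩ := ih _ _ _ _ (g₁.high hx₁) (g₂.high hx₂) (by linarith) (by linarith)
      rw [takagi_high hx₁ g₁.1.2, takagi_high hx₂ g₂.1.2]
      push_cast at a b
      constructor <;> linarith

lemma good_of_Gamma {r : ℕ} {x : ℝ} (hx : x ∈ Gamma r) : GoodState (2 * r) 0 0 x := by
  obtain ⟨h, H⟩ := hx
  refine ⟨⟨h.1, h.2⟩, fun i => ?_⟩
  rcases Nat.eq_zero_or_pos i with rfl | hi
  · simp [defDigit_zero]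
  · simpa using H i hi

lemma main_bound {r : ℕ} (hr : 1 ≤ r) {x₁ x₂ : ℝ} (h₁ : x₁ ∈ Gamma r) (h₂ : x₂ ∈ Gamma r)
    (hlt : x₁ < x₂) :
    ((2 : ℝ) ^ (2 * r))⁻¹ * (x₂ - x₁) ≤ takagi x₂ - takagi x₁ ∧
      takagi x₂ - takagi x₁ ≤ (2 : ℝ) ^ (2 * r) * (x₂ - x₁) := by
  have hpos : 0 < x₂ - x₁ := by linarith
  obtain ⟨n, hn⟩ := pow_unbounded_of_one_lt (1 / (x₂ - x₁)) (one_lt_two : (1 : ℝ) < 2)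
  rw [div_lt_iff₀ hpos] at hn
  have := main_ind (2 * r) (by omega) n 0 0 x₁ x₂ (good_of_Gamma h₁) (good_of_Gamma h₂) hlt hn.le
  simpa using this

/-- The Takagi function restricted to `Γ_{2r}` is strictly increasing and bi-Lipschitz. -/
theorem takagi_strictMono_biLipschitz_on_Gamma (r : ℕ) (hr : 1 ≤ r) :
    StrictMonoOn takagi (Gamma r) ∧
      ∀ x₁ ∈ Gamma r, ∀ x₂ ∈ Gamma r, x₁ ≤ x₂ →
        ((2 : ℝ) ^ (2 * r))⁻¹ * (x₂ - x₁) ≤ takagi x₂ - takagi x₁ ∧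
          takagi x₂ - takagi x₁ ≤ (2 : ℝ) ^ (2 * r) * (x₂ - x₁) := by
  refine ⟨fun x₁ h₁ x₂ h₂ hlt => ?_, fun x₁ h₁ x₂ h₂ hle => ?_⟩
  · have h := (main_bound hr h₁ h₂ hlt).1
    have : 0 < ((2 : ℝ) ^ (2 * r))⁻¹ * (x₂ - x₁) :=
      mul_pos (by positivity) (by linarith)
    linarith
  · rcases hle.eq_or_lt with rfl | hlt
    · simp
    · exact main_bound hr h₁ h₂ hlt
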